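/- Let $C_{n,k}$ (with $k \ge 2$, $n \ge 3$) be any graph obtained from the cycle $C_n$ by attaching between $2$ and $k$ pendant leaves to each cycle vertex. Then $\operatorname{Z}_2(C_{n,k}) \le \log_2(n - 2) + 2k + 1$. -/

import Mathlib

open SimpleGraph

namespace ZqGame

variable {V : Type*}

/-- A blue vertex `v` forces the white vertex `w`, where only white vertices in
`Wallow` are taken into account (used for Rule 3, where play is restricted to the
subgraph induced by the blue set together with the returned white components). -/
def ForceIn (G : SimpleGraph V) (B : Set V) (Wallow : Set V) (v w : V) : Prop :=
  v ∈ B ∧ w ∉ B ∧ w ∈ Wallow ∧ G.Adj v w ∧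
    ∀ u, G.Adj v u → u ∉ B → u ∈ Wallow → u = w

/-- The standard color change rule: `v` is blue and `w` is its unique white neighbor. -/
def Force (G : SimpleGraph V) (B : Set V) (v w : V) : Prop :=
  ForceIn G B Set.univ v w

/-- The white connected component of `G - B` containing the white vertex `w`. -/
def WhiteComp (G : SimpleGraph V) (B : Set V) (w : V) : Set V :=
  {x | Relation.ReflTransGen (fun a b => G.Adj a b ∧ a ∉ B ∧ b ∉ B) w x}

/-- `W` is a white component, i.e. a connected component of `G - B`. -/
def IsWhiteComp (G : SimpleGraph V) (B : Set V) (W : Set V) : Prop :=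
  ∃ w, w ∉ B ∧ W = WhiteComp G B w

/-- An active vertex: a blue vertex with at least two white neighbors. -/
def Active (G : SimpleGraph V) (B : Set V) (a : V) : Prop :=
  a ∈ B ∧ ∃ w₁ w₂, w₁ ≠ w₂ ∧ G.Adj a w₁ ∧ G.Adj a w₂ ∧ w₁ ∉ B ∧ w₂ ∉ B

end ZqGame

namespace ZqGame

variable {V : Type*}

/-- `Win G q B t` : in the `Z_q`-forcing game on `G` starting from blue set `B`,
Blue has a strategy spending at most `t` tokens that colors every vertex blue
against any (adversarial) play by White.
* `all` : every vertex is already blue.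
* `rule1` : spend one token to color an arbitrary vertex blue.
* `rule2` : a blue vertex with exactly one white neighbor forces it, for free.
* `rule3` : Blue announces a collection `𝒲` of at least `q + 1` white components;
  for every nonempty sub-collection `𝒮` that White may return, Blue can perform a
  Rule 2 force (`vf 𝒮 → wf 𝒮`) on the subgraph induced by `B` together with `⋃ 𝒮`,
  and continue from the resulting position. -/
inductive Win (G : SimpleGraph V) (q : ℕ) : Set V → ℕ → Prop
  | all (B : Set V) (t : ℕ) : (∀ v, v ∈ B) → Win G q B t
  | rule1 (B : Set V) (t : ℕ) (v : V) : Win G q (insert v B) t → Win G q B (t + 1)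
  | rule2 (B : Set V) (t : ℕ) (v w : V) :
      Force G B v w → Win G q (insert w B) t → Win G q B t
  | rule3 (B : Set V) (t : ℕ) (𝒲 : Finset (Set V))
      (vf wf : Finset (Set V) → V) :
      (∀ W ∈ 𝒲, IsWhiteComp G B W) → q + 1 ≤ 𝒲.card →
      (∀ 𝒮 : Finset (Set V), 𝒮 ⊆ 𝒲 → 𝒮.Nonempty →
        ForceIn G B (⋃₀ (𝒮 : Set (Set V))) (vf 𝒮) (wf 𝒮)) →
      (∀ 𝒮 : Finset (Set V), 𝒮 ⊆ 𝒲 → 𝒮.Nonempty →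
        Win G q (insert (wf 𝒮) B) t) →
      Win G q B t

/-- `Z_q(G, B)` : the minimum number of additional tokens Blue must spend to win the
`Z_q`-forcing game on `G` starting from blue set `B`. -/
noncomputable def cost (G : SimpleGraph V) (q : ℕ) (B : Set V) : ℕ :=
  sInf {t | Win G q B t}

/-- `Z_q(G)` : the `Z_q`-forcing number of `G`. -/
noncomputable def Zq (G : SimpleGraph V) (q : ℕ) : ℕ := cost G q ∅

end ZqGame

namespace ZqGame

/-- Vertex type of a caterpillar cycle: `Sum.inl i` is the `i`-th center (cycle) vertex,
and `Sum.inr ⟨i, j⟩` is the `j`-th pendant leaf attached to center `i`, where center `i`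
has `f i` pendant leaves. -/
abbrev CatVert (n : ℕ) (f : Fin n → ℕ) : Type := Fin n ⊕ (Σ i : Fin n, Fin (f i))

/-- The caterpillar cycle obtained from the cycle `C_n` by attaching `f i` pendant
leaves to the `i`-th cycle vertex. -/
def catCycle (n : ℕ) (f : Fin n → ℕ) : SimpleGraph (CatVert n f) :=
  SimpleGraph.fromRel (fun x y =>
    match x, y with
    | Sum.inl i, Sum.inl j => ((i : ℕ) + 1) % n = (j : ℕ)
    | Sum.inl i, Sum.inr l => i = l.1
    | _, _ => False)

end ZqGame

namespace ZqGame

section General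

variable {V : Type*} {G : SimpleGraph V} {q : ℕ} {B : Set V} {t : ℕ}

theorem Win.mono {s : ℕ} (h : Win G q B s) (hst : s ≤ t) : Win G q B t := by
  induction h generalizing t with
  | all B s h => exact .all B t h
  | rule1 B s v _ ih =>
    obtain ⟨t, rfl⟩ : ∃ t', t = t' + 1 := ⟨t - 1, by omega⟩
    exact .rule1 B t v (ih (by omega))
  | rule2 B s v w h _ ih => exact .rule2 B t v w h (ih hst)
  | rule3 B s 𝒲 vf wf h₁ h₂ h₃ _ ih =>
    exact .rule3 B t 𝒲 vf wf h₁ h₂ h₃ fun 𝒮 h h' => ih 𝒮 h h' hst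

/-- A vertex that is already blue, or that can be forced, is colored for free. -/
theorem Win.of_insert {w : V} (hw : w ∉ B → ∃ v, Force G B v w)
    (h : Win G q (insert w B) t) : Win G q B t := by
  by_cases hB : w ∈ B
  · rwa [Set.insert_eq_of_mem hB] at h
  · obtain ⟨v, hv⟩ := hw hB
    exact .rule2 B t v w hv h

theorem Win.of_union (T : Finset V) (h : Win G q (B ∪ T) t) : Win G q B (t + T.card) := by
  classical
  induction T using Finset.induction_on generalizing B with
  | empty => simpa using h
  | insert a T ha ih =>
    rw [Finset.card_insert_of_notMem ha, ← add_assoc]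
    refine .rule1 B _ a (ih ?_)
    rwa [Finset.coe_insert, Set.union_insert, ← Set.insert_union] at h

theorem mem_whiteComp_self (w : V) : w ∈ WhiteComp G B w := Relation.ReflTransGen.refl

/-- A set containing `w` and closed under white adjacency contains the white component of `w`. -/
theorem whiteComp_subset {S : Set V} {w : V} (hw : w ∈ S)
    (hS : ∀ a ∈ S, ∀ b, G.Adj a b → b ∉ B → b ∈ S) : WhiteComp G B w ⊆ S := by
  intro x hx
  induction hx with
  | refl => exact hw
  | tail _ hab ih => exact hS _ ih _ hab.1 hab.2.2

/-- Rule 3 with `q = 2`, applied to the component of `w₁` and two isolated white vertices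
`w₂`, `w₃`. -/
theorem Win.of_three_components {v₁ v₂ v₃ w₁ w₂ w₃ : V}
    (hv₁ : v₁ ∈ B) (hv₂ : v₂ ∈ B) (hv₃ : v₃ ∈ B) (hw₁ : w₁ ∉ B) (hw₂ : w₂ ∉ B) (hw₃ : w₃ ∉ B)
    (ha₁ : G.Adj v₁ w₁) (ha₂ : G.Adj v₂ w₂) (ha₃ : G.Adj v₃ w₃)
    (hc₁ : ∀ u ∈ WhiteComp G B w₁, G.Adj v₁ u → u = w₁)
    (hc₂ : WhiteComp G B w₂ = {w₂}) (hc₃ : WhiteComp G B w₃ = {w₃})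
    (h₁₂ : w₁ ≠ w₂) (h₁₃ : w₁ ≠ w₃) (h₂₃ : w₂ ≠ w₃)
    (hn₁₂ : ¬ G.Adj v₁ w₂) (hn₁₃ : ¬ G.Adj v₁ w₃) (hn₂₃ : ¬ G.Adj v₂ w₃)
    (hwin : ∀ w ∉ B, Win G 2 (insert w B) t) : Win G 2 B t := by
  classical
  have hself : w₁ ∈ WhiteComp G B w₁ := mem_whiteComp_self w₁
  set W := WhiteComp G B w₁ with hW
  have hW₂ : W ≠ {w₂} := fun h => h₁₂ (by simpa [h] using hself)
  have hW₃ : W ≠ {w₃} := fun h => h₁₃ (by simpa [h] using hself)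
  have h₂₃' : ({w₂} : Set V) ≠ {w₃} := fun h => h₂₃ (Set.singleton_injective h)
  let vf : Finset (Set V) → V := fun 𝒮 => if W ∈ 𝒮 then v₁ else if {w₂} ∈ 𝒮 then v₂ else v₃
  let wf : Finset (Set V) → V := fun 𝒮 => if W ∈ 𝒮 then w₁ else if {w₂} ∈ 𝒮 then w₂ else w₃
  have hforce : ∀ 𝒮 : Finset (Set V), 𝒮 ⊆ {W, {w₂}, {w₃}} → 𝒮.Nonempty →
      ForceIn G B (⋃₀ (𝒮 : Set (Set V))) (vf 𝒮) (wf 𝒮) := by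
    intro 𝒮 hsub ⟨X, hX⟩
    have hcases : ∀ Y ∈ 𝒮, Y = W ∨ Y = {w₂} ∨ Y = {w₃} := fun Y hY => by
      simpa using hsub hY
    by_cases hWS : W ∈ 𝒮
    · simp only [vf, wf, if_pos hWS]
      refine ⟨hv₁, hw₁, ⟨W, hWS, hself⟩, ha₁, ?_⟩
      rintro u hu - ⟨Y, hY, huY⟩
      rcases hcases Y hY with rfl | rfl | rfl
      · exact hc₁ u huY hu
      · exact absurd (Set.mem_singleton_iff.1 huY ▸ hu) hn₁₂
      · exact absurd (Set.mem_singleton_iff.1 huY ▸ hu) hn₁₃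
    · by_cases h2S : {w₂} ∈ 𝒮
      · simp only [vf, wf, if_neg hWS, if_pos h2S]
        refine ⟨hv₂, hw₂, ⟨{w₂}, h2S, rfl⟩, ha₂, ?_⟩
        rintro u hu - ⟨Y, hY, huY⟩
        rcases hcases Y hY with rfl | rfl | rfl
        · exact absurd hY hWS
        · exact huY
        · exact absurd (Set.mem_singleton_iff.1 huY ▸ hu) hn₂₃
      · simp only [vf, wf, if_neg hWS, if_neg h2S]
        have h3S : ({w₃} : Set V) ∈ 𝒮 := by
          rcases hcases X hX with rfl | rfl | rfl
          · exact absurd hX hWS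
          · exact absurd hX h2S
          · exact hX
        refine ⟨hv₃, hw₃, ⟨{w₃}, h3S, rfl⟩, ha₃, ?_⟩
        rintro u hu - ⟨Y, hY, huY⟩
        rcases hcases Y hY with rfl | rfl | rfl
        · exact absurd hY hWS
        · exact absurd hY h2S
        · exact huY
  refine .rule3 B t {W, {w₂}, {w₃}} vf wf ?_ ?_ hforce
    fun 𝒮 h h' => hwin _ (hforce 𝒮 h h').2.1
  · intro Y hY
    simp only [Finset.mem_insert, Finset.mem_singleton] at hY
    rcases hY with rfl | rfl | rfl
    · exact ⟨w₁, hw₁, hW⟩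
    · exact ⟨w₂, hw₂, hc₂.symm⟩
    · exact ⟨w₃, hw₃, hc₃.symm⟩
  · rw [Finset.card_eq_three.2 ⟨W, {w₂}, {w₃}, hW₂, hW₃, h₂₃', rfl⟩]

end General

section CatCycle

variable {n : ℕ} {f : Fin n → ℕ} {B : Set (CatVert n f)} {t : ℕ}

theorem adj_leaf (i : Fin n) (j : Fin (f i)) :
    (catCycle n f).Adj (Sum.inl i) (Sum.inr ⟨i, j⟩) := by
  simp [catCycle, SimpleGraph.fromRel_adj]

theorem eq_of_adj_leaf {i : Fin n} {l : Σ i : Fin n, Fin (f i)}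
    (h : (catCycle n f).Adj (Sum.inl i) (Sum.inr l)) : i = l.1 := by
  simpa [catCycle, SimpleGraph.fromRel_adj] using h

theorem eq_center_of_adj_leaf {l : Σ i : Fin n, Fin (f i)} {v : CatVert n f}
    (h : (catCycle n f).Adj (Sum.inr l) v) : v = Sum.inl l.1 := by
  rcases v with i | l'
  · rw [eq_of_adj_leaf h.symm]
  · simp [catCycle, SimpleGraph.fromRel_adj] at h

/-- A center is leafy if it is blue and has a white leaf. -/
def Leafy (B : Set (CatVert n f)) (i : Fin n) : Prop :=
  Sum.inl i ∈ B ∧ ∃ j : Fin (f i), (Sum.inr ⟨i, j⟩ : CatVert n f) ∉ B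

theorem whiteComp_leaf {l : Σ i : Fin n, Fin (f i)} (h : (Sum.inl l.1 : CatVert n f) ∈ B) :
    WhiteComp (catCycle n f) B (Sum.inr l) = {Sum.inr l} := by
  refine Set.Subset.antisymm (whiteComp_subset rfl ?_) ?_
  · rintro a rfl b hab hb
    exact absurd (eq_center_of_adj_leaf hab ▸ h) hb
  · rintro _ rfl
    exact mem_whiteComp_self _

theorem Win.of_three_leafy {x y z : Fin n} (hx : Leafy B x) (hy : Leafy B y) (hz : Leafy B z)
    (hxy : x ≠ y) (hxz : x ≠ z) (hyz : y ≠ z)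
    (hwin : ∀ w ∉ B, Win (catCycle n f) 2 (insert w B) t) : Win (catCycle n f) 2 B t := by
  obtain ⟨hx, jx, hjx⟩ := hx
  obtain ⟨hy, jy, hjy⟩ := hy
  obtain ⟨hz, jz, hjz⟩ := hz
  refine Win.of_three_components hx hy hz hjx hjy hjz (adj_leaf x jx) (adj_leaf y jy)
    (adj_leaf z jz) ?_ (whiteComp_leaf hy) (whiteComp_leaf hz) ?_ ?_ ?_
    (fun h => hxy (eq_of_adj_leaf h)) (fun h => hxz (eq_of_adj_leaf h))
    (fun h => hyz (eq_of_adj_leaf h)) hwin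
  · intro u hu _
    rwa [whiteComp_leaf (l := ⟨x, jx⟩) hx] at hu
  all_goals
    intro h
    have h' := congrArg Sigma.fst (Sum.inr.inj h)
    contradiction

/-- A token on a leaf also colors its center. -/
theorem Win.of_leaf_token {q : ℕ} {i : Fin n} (j : Fin (f i))
    (h : Win (catCycle n f) q (insert (Sum.inl i) (insert (Sum.inr ⟨i, j⟩) B)) t) :
    Win (catCycle n f) q B (t + 1) := by
  refine .rule1 B t (Sum.inr ⟨i, j⟩) (Win.of_insert (fun hw => ?_) h)
  exact ⟨Sum.inr ⟨i, j⟩, Set.mem_insert _ _, hw, trivial, (adj_leaf i j).symm,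
    fun u hu _ _ => eq_center_of_adj_leaf hu⟩

theorem Win.of_leafy_pair {k : ℕ} (hf : ∀ i, 2 ≤ f i ∧ f i ≤ k) (x y : Fin n)
    (hcenter : ∀ i, (Sum.inl i : CatVert n f) ∈ B) (hleafy : ∀ i, Leafy B i → i = x ∨ i = y) :
    Win (catCycle n f) 2 B (2 * (k - 1)) := by
  classical
  have hpos : ∀ i, 0 < f i := fun i => lt_of_lt_of_le two_pos (hf i).1
  let root : (i : Fin n) → CatVert n f := fun i => Sum.inr ⟨i, ⟨0, hpos i⟩⟩
  let T : Fin n → Finset (CatVert n f) := fun i =>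
    (Finset.univ.erase (⟨0, hpos i⟩ : Fin (f i))).image fun j => Sum.inr ⟨i, j⟩
  have hT : ∀ i, (T i).card ≤ k - 1 := fun i => by
    refine Finset.card_image_le.trans ?_
    rw [Finset.card_erase_of_mem (Finset.mem_univ _), Finset.card_univ, Fintype.card_fin]
    exact Nat.sub_le_sub_right (hf i).2 1
  have hcard : 0 + (T x ∪ T y).card ≤ 2 * (k - 1) := by
    have := Finset.card_union_le (T x) (T y)
    have := hT x
    have := hT y
    omega
  refine Win.mono (Win.of_union (T x ∪ T y) ?_) hcard
  have hmem : ∀ (i : Fin n) (j : Fin (f i)), i = x ∨ i = y →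
      (Sum.inr ⟨i, j⟩ : CatVert n f) ∉ B ∪ ↑(T x ∪ T y) → Sum.inr ⟨i, j⟩ = root i := by
    intro i j hi hj
    by_contra hne
    have hj0 : j ≠ ⟨0, hpos i⟩ := fun h => hne (by rw [h])
    have : (Sum.inr ⟨i, j⟩ : CatVert n f) ∈ T i :=
      Finset.mem_image_of_mem _ (Finset.mem_erase.2 ⟨hj0, Finset.mem_univ _⟩)
    refine hj (Or.inr ?_)
    rw [Finset.mem_coe, Finset.mem_union]
    rcases hi with rfl | rfl
    · exact Or.inl this
    · exact Or.inr this
  have hforce : ∀ C : Set (CatVert n f), B ∪ ↑(T x ∪ T y) ⊆ C → ∀ i, i = x ∨ i = y →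
      root i ∉ C → ∃ v, Force (catCycle n f) C v (root i) := by
    intro C hC i hi hr
    refine ⟨Sum.inl i, hC (Or.inl (hcenter i)), hr, trivial, adj_leaf i _, ?_⟩
    rintro (a | ⟨a, j⟩) hu huC -
    · exact absurd (hC (Or.inl (hcenter a))) huC
    · obtain rfl : i = a := eq_of_adj_leaf hu
      exact hmem i j hi fun h => huC (hC h)
  refine Win.of_insert (hforce _ subset_rfl x (Or.inl rfl)) ?_
  refine Win.of_insert (hforce _ (Set.subset_insert _ _) y (Or.inr rfl)) ?_
  refine .all _ _ ?_
  rintro (a | ⟨a, j⟩)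
  · exact Or.inr (Or.inr (Or.inl (hcenter a)))
  · by_contra h
    have hB : (Sum.inr ⟨a, j⟩ : CatVert n f) ∉ B := fun h' => h (Or.inr (Or.inr (Or.inl h')))
    have ha := hleafy a ⟨hcenter a, j, hB⟩
    have hroot := hmem a j ha fun h' => h (Or.inr (Or.inr h'))
    rw [hroot] at h
    rcases ha with rfl | rfl
    · exact h (Or.inr (Or.inl rfl))
    · exact h (Or.inl rfl)

variable [NeZero n]

/-- The cycle position of index `i`, with indices read modulo `n`. -/
def pos (n : ℕ) [NeZero n] (i : ℕ) : Fin n := Fin.ofNat n i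

theorem pos_eq_iff {i j : ℕ} : pos n i = pos n j ↔ i ≡ j [MOD n] := by
  simp [pos, Fin.ext_iff, Nat.ModEq]

theorem pos_val (a : Fin n) : pos n a = a := by
  ext
  simp [pos]

theorem pos_add_self (i : ℕ) : pos n (i + n) = pos n i :=
  pos_eq_iff.2 (Nat.add_modEq_right)

/-- Every position has an index in each window of `n` consecutive indices. -/
theorem exists_modEq_window (s i : ℕ) : ∃ d < n, s + d ≡ i [MOD n] := by
  refine ⟨(i + (n - s % n)) % n, Nat.mod_lt _ (NeZero.pos n), ?_⟩
  have hs : s % n ≤ n := (Nat.mod_lt _ (NeZero.pos n)).le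
  calc s + (i + (n - s % n)) % n ≡ s % n + (i + (n - s % n)) [MOD n] :=
        (Nat.mod_modEq s n).symm.add (Nat.mod_modEq _ n)
    _ = i + n := by omega
    _ ≡ i [MOD n] := Nat.add_modEq_right

theorem adj_pos_succ (hn : 2 ≤ n) (p : ℕ) :
    (catCycle n f).Adj (Sum.inl (pos n p)) (Sum.inl (pos n (p + 1))) := by
  have hne : pos n p ≠ pos n (p + 1) := by
    intro h
    have h' : p + 0 ≡ p + 1 [MOD n] := pos_eq_iff.1 h
    have := (Nat.ModEq.add_left_cancel' p h').eq_of_lt_of_lt (by omega) (by omega)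
    omega
  simp [catCycle, SimpleGraph.fromRel_adj, hne]
  simp [pos]

theorem eq_of_adj_pos {p : ℕ} {b : Fin n}
    (h : (catCycle n f).Adj (Sum.inl (pos n (p + 1))) (Sum.inl b)) :
    b = pos n p ∨ b = pos n (p + 2) := by
  rw [catCycle, SimpleGraph.fromRel_adj] at h
  rcases h.2 with h | h
  · right
    rw [← pos_val b, pos_eq_iff]
    have h' : ((p + 1) % n + 1) % n = (b : ℕ) := h
    rw [← h']
    exact (Nat.mod_modEq _ n).trans ((Nat.mod_modEq _ n).add_right 1)
  · left
    rw [← pos_val b, pos_eq_iff]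
    have h' : ((b : ℕ) + 1) % n = (p + 1) % n := h
    exact Nat.ModEq.add_right_cancel' 1 h'

/-- A blue center with no white leaf and exactly one white cycle neighbor, its successor,
forces it. -/
theorem force_succ (hn : 2 ≤ n) {p : ℕ} (h₀ : Sum.inl (pos n p) ∈ B)
    (h₁ : Sum.inl (pos n (p + 1)) ∈ B) (h₂ : Sum.inl (pos n (p + 2)) ∉ B)
    (hleafy : ¬ Leafy B (pos n (p + 1))) :
    Force (catCycle n f) B (Sum.inl (pos n (p + 1))) (Sum.inl (pos n (p + 2))) := by
  refine ⟨h₁, h₂, trivial, adj_pos_succ hn (p + 1), ?_⟩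
  rintro (b | ⟨b, j⟩) hu hub -
  · rcases eq_of_adj_pos hu with rfl | rfl
    · exact absurd h₀ hub
    · rfl
  · obtain rfl := eq_of_adj_leaf hu
    exact absurd ⟨h₁, j, hub⟩ hleafy

theorem force_pred (hn : 2 ≤ n) {p : ℕ} (h₀ : Sum.inl (pos n p) ∉ B)
    (h₁ : Sum.inl (pos n (p + 1)) ∈ B) (h₂ : Sum.inl (pos n (p + 2)) ∈ B)
    (hleafy : ¬ Leafy B (pos n (p + 1))) :
    Force (catCycle n f) B (Sum.inl (pos n (p + 1))) (Sum.inl (pos n p)) := by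
  refine ⟨h₁, h₀, trivial, (adj_pos_succ hn p).symm, ?_⟩
  rintro (b | ⟨b, j⟩) hu hub -
  · rcases eq_of_adj_pos hu with rfl | rfl
    · rfl
    · exact absurd h₂ hub
  · obtain rfl := eq_of_adj_leaf hu
    exact absurd ⟨h₁, j, hub⟩ hleafy

/-- The white component of a white center lying strictly between two blue centers stays
strictly between them. -/
theorem whiteComp_subset_arc {p q w : ℕ} (hp : Sum.inl (pos n p) ∈ B)
    (hq : Sum.inl (pos n q) ∈ B) (hpw : p < w) (hwq : w < q) {i : Fin n}
    (hi : Sum.inl i ∈ WhiteComp (catCycle n f) B (Sum.inl (pos n w))) :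
    ∃ j, p < j ∧ j < q ∧ i = pos n j := by
  let S : Set (CatVert n f) := {v | ∃ j, p < j ∧ j < q ∧ Sum.elim id Sigma.fst v = pos n j}
  have hS : WhiteComp (catCycle n f) B (Sum.inl (pos n w)) ⊆ S := by
    refine whiteComp_subset ⟨w, hpw, hwq, rfl⟩ ?_
    rintro (a | l) ⟨j, hpj, hjq, ha⟩ (b | l') hab hb
    · obtain ⟨j, rfl⟩ : ∃ j', j = j' + 1 := ⟨j - 1, by omega⟩
      obtain rfl : a = pos n (j + 1) := ha
      rcases eq_of_adj_pos hab with rfl | rfl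
      · refine ⟨j, lt_of_le_of_ne (by omega) ?_, by omega, rfl⟩
        rintro rfl
        exact hb hp
      · refine ⟨j + 2, by omega, lt_of_le_of_ne (by omega) ?_, rfl⟩
        rintro rfl
        exact hb hq
    · exact ⟨j, hpj, hjq, (eq_of_adj_leaf hab).symm.trans ha⟩
    · exact ⟨j, hpj, hjq, (eq_of_adj_leaf hab.symm).trans ha⟩
    · exact absurd (eq_center_of_adj_leaf hab) (by simp)
  exact hS hi

/-- A blue center without white leaves advances into an adjacent white arc if two other
centers are leafy. -/
theorem Win.of_arc (hn : 2 ≤ n) {p : ℕ} {x y : Fin n} (h₁ : Sum.inl (pos n (p + 1)) ∈ B)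
    (h₂ : Sum.inl (pos n (p + 2)) ∉ B) (hleafy : ¬ Leafy B (pos n (p + 1)))
    (hx : Leafy B x) (hy : Leafy B y) (hxy : x ≠ y)
    (hwin : ∀ w ∉ B, Win (catCycle n f) 2 (insert w B) t) : Win (catCycle n f) 2 B t := by
  have hpx : pos n (p + 1) ≠ x := fun h => hleafy (h ▸ hx)
  have hpy : pos n (p + 1) ≠ y := fun h => hleafy (h ▸ hy)
  obtain ⟨hx, jx, hjx⟩ := hx
  obtain ⟨hy, jy, hjy⟩ := hy
  refine Win.of_three_components h₁ hx hy h₂ hjx hjy (adj_pos_succ hn (p + 1)) (adj_leaf x jx)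
    (adj_leaf y jy) ?_ (whiteComp_leaf hx) (whiteComp_leaf hy) (by simp) (by simp) ?_
    (fun h => hpx (eq_of_adj_leaf h)) (fun h => hpy (eq_of_adj_leaf h))
    (fun h => hxy (eq_of_adj_leaf h)) hwin
  · have hout : ∀ l, (Sum.inr l : CatVert n f) ∉ B →
        ¬ (catCycle n f).Adj (Sum.inl (pos n (p + 1))) (Sum.inr l) := by
      rintro ⟨b, j⟩ hb hu
      obtain rfl := eq_of_adj_leaf hu
      exact hleafy ⟨h₁, j, hb⟩
    obtain ⟨d, hd, hdx⟩ := exists_modEq_window (n := n) (p + 1) x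
    have hposx : pos n (p + 1 + d) = x := (pos_eq_iff.2 hdx).trans (pos_val x)
    have hd0 : d ≠ 0 := by
      rintro rfl
      exact hpx hposx
    have hd1 : d ≠ 1 := by
      rintro rfl
      exact h₂ (hposx ▸ hx)
    have hwhite : ∀ u ∈ WhiteComp (catCycle n f) B (Sum.inl (pos n (p + 2))), u ∉ B :=
      whiteComp_subset (S := Bᶜ) h₂ fun _ _ _ _ h => h
    rintro (b | l) hu hadj
    · rcases eq_of_adj_pos hadj with rfl | rfl
      · obtain ⟨j, hj₁, hj₂, hj⟩ := whiteComp_subset_arc (w := p + 2) h₁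
          (by rw [hposx]; exact hx : Sum.inl (pos n (p + 1 + d)) ∈ B) (by omega) (by omega) hu
        obtain ⟨e, rfl⟩ : ∃ e, j = p + e := ⟨j - p, by omega⟩
        have h' : p + 0 ≡ p + e [MOD n] := pos_eq_iff.1 hj
        have := (Nat.ModEq.add_left_cancel' p h').eq_of_lt_of_lt (by omega) (by omega)
        omega
      · rfl
    · exact absurd hadj (hout l (hwhite _ hu))
  · intro h
    exact hxy (congrArg Sigma.fst (Sum.inr.inj h))

theorem exists_last_before_failure {P : ℕ → Prop} {a b : ℕ} (hab : a ≤ b) (ha : P a) (hb : ¬ P b) :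
    ∃ j, P j ∧ ¬ P (j + 1) := by
  by_contra! h
  exact hb (Nat.le_induction ha (fun j _ => h j) b hab)

/-- Blue wins with `t + 2 (k - 1)` tokens once two consecutive centers are blue and every
`2 ^ t` consecutive centers include a blue one. -/
theorem win_of_gap {k : ℕ} (hn : 2 ≤ n) (hf : ∀ i, 2 ≤ f i ∧ f i ≤ k) (B : Set (CatVert n f))
    (t : ℕ) (hadj : ∃ i, Sum.inl (pos n i) ∈ B ∧ Sum.inl (pos n (i + 1)) ∈ B)
    (hgap : ∀ i, ∃ j < 2 ^ t, Sum.inl (pos n (i + j)) ∈ B) :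
    Win (catCycle n f) 2 B (t + 2 * (k - 1)) := by
  induction B using WellFoundedGT.induction generalizing t with
  | ind B ih =>
  have hstep : ∀ w ∉ B, Win (catCycle n f) 2 (insert w B) (t + 2 * (k - 1)) := by
    intro w hw
    refine ih _ (Set.ssubset_insert hw) t ?_ fun i => ?_
    · obtain ⟨i, h₁, h₂⟩ := hadj
      exact ⟨i, Or.inr h₁, Or.inr h₂⟩
    · obtain ⟨j, hj, h⟩ := hgap i
      exact ⟨j, hj, Or.inr h⟩
  by_cases hforce : ∃ v w, Force (catCycle n f) B v w
  · obtain ⟨v, w, h⟩ := hforce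
    exact .rule2 B _ v w h (hstep w h.2.1)
  by_cases hthree : ∃ x y z, Leafy B x ∧ Leafy B y ∧ Leafy B z ∧ x ≠ y ∧ x ≠ z ∧ y ≠ z
  · obtain ⟨x, y, z, hx, hy, hz, hxy, hxz, hyz⟩ := hthree
    exact Win.of_three_leafy hx hy hz hxy hxz hyz hstep
  push Not at hforce hthree
  by_cases hall : ∀ i, (Sum.inl i : CatVert n f) ∈ B
  · obtain ⟨x, y, hxy⟩ : ∃ x y, ∀ i, Leafy B i → i = x ∨ i = y := by
      by_cases hex : ∃ x y, Leafy B x ∧ Leafy B y ∧ x ≠ y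
      · obtain ⟨x, y, hx, hy, hne⟩ := hex
        refine ⟨x, y, fun i hi => ?_⟩
        by_contra! h
        exact h.2.symm (hthree x y i hx hy hi hne h.1.symm)
      · push Not at hex
        by_cases hone : ∃ x, Leafy B x
        · obtain ⟨x, hx⟩ := hone
          exact ⟨x, x, fun i hi => Or.inl (hex i x hi hx)⟩
        · exact ⟨0, 0, fun i hi => absurd ⟨i, hi⟩ hone⟩
    exact (Win.of_leafy_pair hf x y hall hxy).mono (by omega)
  push Not at hall
  obtain ⟨a, ha⟩ := hall
  obtain ⟨i, hi₁, hi₂⟩ := hadj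
  obtain ⟨d, -, hd⟩ := exists_modEq_window (n := n) i a
  have hda : Sum.inl (pos n (i + d)) ∉ B := by rwa [pos_eq_iff.2 hd, pos_val]
  obtain ⟨y, ⟨hy₀, hy₁⟩, hy₂⟩ := exists_last_before_failure
    (P := fun j => Sum.inl (pos n j) ∈ B ∧ Sum.inl (pos n (j + 1)) ∈ B) (Nat.le_add_right i d)
    ⟨hi₁, hi₂⟩ fun h => hda h.1
  replace hy₂ : Sum.inl (pos n (y + 2)) ∉ B := fun h => hy₂ ⟨hy₁, h⟩
  obtain ⟨e, -, he⟩ := exists_modEq_window (n := n) a i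
  obtain ⟨x, hx₀, hx⟩ := exists_last_before_failure
    (P := fun j => ¬ (Sum.inl (pos n j) ∈ B ∧ Sum.inl (pos n (j + 1)) ∈ B))
    (Nat.le_add_right a e) (fun h => ha (by simpa only [pos_val] using h.1))
    (not_not.2 ⟨by rwa [pos_eq_iff.2 he], by rwa [pos_eq_iff.2 (he.add_right 1)]⟩)
  obtain ⟨hx₁, hx₂⟩ := not_not.1 hx
  replace hx₀ : Sum.inl (pos n x) ∉ B := fun h => hx₀ ⟨h, hx₁⟩
  have hyL : Leafy B (pos n (y + 1)) := by
    by_contra h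
    exact hforce _ _ (force_succ hn hy₀ hy₁ hy₂ h)
  have hxL : Leafy B (pos n (x + 1)) := by
    by_contra h
    exact hforce _ _ (force_pred hn hx₀ hx₁ hx₂ h)
  have hxy : pos n (x + 1) ≠ pos n (y + 1) := by
    intro h
    rw [pos_eq_iff.2 ((pos_eq_iff.1 h).add_right 1)] at hx₂
    exact hy₂ hx₂
  have honly : ∀ i, Leafy B i → i = pos n (x + 1) ∨ i = pos n (y + 1) := by
    intro i hi
    by_contra! h
    exact h.2.symm (hthree _ _ i hxL hyL hi hxy h.1.symm)
  by_cases harc : ∃ p, Sum.inl (pos n (p + 1)) ∈ B ∧ Sum.inl (pos n (p + 2)) ∉ B ∧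
      ¬ Leafy B (pos n (p + 1))
  · obtain ⟨p, h₁, h₂, h⟩ := harc
    exact Win.of_arc hn h₁ h₂ h hxL hyL hxy hstep
  push Not at harc
  -- Only one white arc is left, running from `y + 2` to `y + 2 + s`.
  obtain ⟨r, hr, hrB⟩ := hgap (y + 2)
  classical
  have hex : ∃ r, Sum.inl (pos n (y + 2 + r)) ∈ B := ⟨r, hrB⟩
  obtain ⟨r, hrt, hrB, hrmin⟩ : ∃ r < 2 ^ t, Sum.inl (pos n (y + 2 + r)) ∈ B ∧
      ∀ s < r, Sum.inl (pos n (y + 2 + s)) ∉ B :=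
    ⟨Nat.find hex, (Nat.find_le hrB).trans_lt hr, Nat.find_spec hex,
      fun s hs => Nat.find_min hex hs⟩
  have hr0 : r ≠ 0 := by
    rintro rfl
    exact hy₂ hrB
  obtain ⟨s, rfl⟩ := Nat.exists_eq_succ_of_ne_zero hr0
  have hblue : ∀ j, y + 2 + s + 1 ≤ j → j ≤ y + 1 + n → Sum.inl (pos n j) ∈ B := by
    intro j hj
    induction j, hj using Nat.le_induction with
    | base => exact fun _ => hrB
    | succ j hj ihj =>
      intro hjn
      have hjB := ihj (by omega)
      obtain ⟨j, rfl⟩ : ∃ j', j = j' + 1 := ⟨j - 1, by omega⟩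
      by_contra hnext
      rcases honly _ (harc j hjB hnext) with h | h
      · rw [pos_eq_iff.2 ((pos_eq_iff.1 h).add_right 1)] at hnext
        exact hnext hx₂
      · obtain ⟨e, rfl⟩ : ∃ e, j = y + e := ⟨j - y, by omega⟩
        have h' : y + e ≡ y + 0 [MOD n] := Nat.ModEq.add_right_cancel' 1 (pos_eq_iff.1 h)
        have := (Nat.ModEq.add_left_cancel' y h').eq_of_lt_of_lt (by omega) (by omega)
        omega
  obtain ⟨t, rfl⟩ : ∃ t', t = t' + 1 := by
    refine ⟨t - 1, (Nat.succ_pred_eq_of_ne_zero ?_).symm⟩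
    rintro rfl
    omega
  rw [pow_succ] at hrt
  have hmid : Sum.inl (pos n (y + 2 + (s + 1) / 2)) ∉ B := hrmin _ (by omega)
  have hpos : 0 < f (pos n (y + 2 + (s + 1) / 2)) := lt_of_lt_of_le two_pos (hf _).1
  rw [add_right_comm]
  refine Win.of_leaf_token ⟨0, hpos⟩ (ih _ ?_ t ⟨y, Or.inr (Or.inr hy₀), Or.inr (Or.inr hy₁)⟩ ?_)
  · refine (Set.ssubset_iff_of_subset ?_).2 ⟨_, Set.mem_insert _ _, hmid⟩
    exact (Set.subset_insert _ _).trans (Set.subset_insert _ _)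
  · intro i
    obtain ⟨d, hd, hdi⟩ := exists_modEq_window (n := n) (y + 2) i
    have hshift : ∀ j, pos n (i + j) = pos n (y + 2 + d + j) := fun j =>
      pos_eq_iff.2 (hdi.symm.add_right j)
    simp only [hshift]
    rcases le_or_gt d ((s + 1) / 2) with h | h
    · refine ⟨(s + 1) / 2 - d, by omega, ?_⟩
      rw [show y + 2 + d + ((s + 1) / 2 - d) = y + 2 + (s + 1) / 2 by omega]
      exact Set.mem_insert _ _
    · rcases le_or_gt d (s + 1) with h' | h'
      · refine ⟨s + 1 - d, by omega, Or.inr (Or.inr ?_)⟩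
        rwa [show y + 2 + d + (s + 1 - d) = y + 2 + (s + 1) by omega]
      · exact ⟨0, by positivity, Or.inr (Or.inr (hblue _ (by omega) (by omega)))⟩

theorem win_empty {k : ℕ} (hn : 3 ≤ n) (hf : ∀ i, 2 ≤ f i ∧ f i ≤ k) :
    Win (catCycle n f) 2 ∅ (Nat.log 2 (n - 2) + 1 + 2 * (k - 1) + 1 + 1) := by
  have hpos : ∀ i, 0 < f i := fun i => lt_of_lt_of_le two_pos (hf i).1
  refine Win.of_leaf_token (i := pos n 0) ⟨0, hpos _⟩
    (Win.of_leaf_token (i := pos n 1) ⟨0, hpos _⟩ (win_of_gap (by omega) hf _ _ ⟨0, ?_, ?_⟩ ?_))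
  · exact Or.inr (Or.inr (Or.inl rfl))
  · exact Or.inl rfl
  · intro i
    have hlog : n - 2 < 2 ^ (Nat.log 2 (n - 2) + 1) := Nat.lt_pow_succ_log_self one_lt_two _
    obtain ⟨d, hd, hdi⟩ := exists_modEq_window (n := n) 1 i
    have hshift : ∀ j, pos n (i + j) = pos n (1 + d + j) := fun j =>
      pos_eq_iff.2 (hdi.symm.add_right j)
    simp only [hshift]
    rcases Nat.eq_zero_or_pos d with rfl | hd0
    · exact ⟨0, by positivity, Or.inl rfl⟩
    · refine ⟨n - (1 + d), by omega, Or.inr (Or.inr (Or.inl ?_))⟩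
      rw [show 1 + d + (n - (1 + d)) = 0 + n by omega, pos_add_self]

end CatCycle

end ZqGame

open SimpleGraph

/-- Upper bound for `q = 2` on caterpillar cycles: if `C_{n,k}` is obtained from the
cycle `C_n` (`n ≥ 3`) by attaching between `2` and `k` pendant leaves to each cycle
vertex (`k ≥ 2`), then `Z_2(C_{n,k}) ≤ log₂ (n - 2) + 2k + 1`. -/
theorem Z2_catCycle_upper (n k : ℕ) (hn : 3 ≤ n) (hk : 2 ≤ k) (f : Fin n → ℕ)
    (hf : ∀ i, 2 ≤ f i ∧ f i ≤ k) :
    (ZqGame.Zq (ZqGame.catCycle n f) 2 : ℝ) ≤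
      Real.logb 2 ((n : ℝ) - 2) + 2 * (k : ℝ) + 1 := by
  have : NeZero n := ⟨by omega⟩
  have hwin := ZqGame.win_empty hn hf
  have hle : ZqGame.Zq (ZqGame.catCycle n f) 2 ≤ Nat.log 2 (n - 2) + 1 + 2 * (k - 1) + 1 + 1 :=
    Nat.sInf_le hwin
  have hlog : (Nat.log 2 (n - 2) : ℝ) ≤ Real.logb 2 ((n : ℝ) - 2) := by
    have h := Real.natLog_le_logb (n - 2) 2
    rwa [Nat.cast_sub (by omega)] at h
  have hle' : ZqGame.Zq (ZqGame.catCycle n f) 2 ≤ Nat.log 2 (n - 2) + 2 * k + 1 := by omega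
  have hcast : (ZqGame.Zq (ZqGame.catCycle n f) 2 : ℝ) ≤
      (Nat.log 2 (n - 2) : ℝ) + 2 * (k : ℝ) + 1 := by exact_mod_cast hle'
  linarith
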